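/- arXiv:1705.02641 — 2 statements merged into one kernel-verified Lean document; each statement's English description precedes it below -/
import Mathlib

section
/- (Uniqueness part of Lemma 4.1) Let P, Q, R, P', Q', R' ∈ ℤ[t,t⁻¹] be Laurent polynomials such that for every m ∈ ℕ one has P·S_m(t⁻¹) + Q + R·S_m(t) = P'·S_m(t⁻¹) + Q' + R'·S_m(t). Then P = P', Q = Q' and R = R'. -/
open LaurentPolynomial

noncomputable section

/-- The ring of Laurent polynomials `ℤ[t,t⁻¹]`. -/
abbrev L := LaurentPolynomial ℤ

/-- `S m x = ∑_{k=0}^{m} (−x)^k`, the `m`-th partial sum of the geometric series with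
initial term `1` and ratio `−x`. -/
def S (m : ℕ) (x : L) : L := ∑ k ∈ Finset.range (m + 1), (-x) ^ k

theorem S_zero (x : L) : S 0 x = 1 := by simp [S]

theorem S_succ (m : ℕ) (x : L) : S (m + 1) x = S m x + (-x) ^ (m + 1) :=
  Finset.sum_range_succ _ _

theorem T_two_ne_one : (T 2 : L) ≠ 1 := fun h => by
  have h' := Finsupp.single_left_injective (one_ne_zero (α := ℤ)) (congrArg AddMonoidAlgebra.coeff h)
  omega

/-- (Uniqueness part of Lemma 4.1) If `P·S_m(t⁻¹) + Q + R·S_m(t) = P'·S_m(t⁻¹) + Q' + R'·S_m(t)`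
for every `m ∈ ℕ`, then `P = P'`, `Q = Q'` and `R = R'`. -/
theorem decomposition_unique (P Q R P' Q' R' : L)
    (h : ∀ m : ℕ,
      P * S m (T (-1)) + Q + R * S m (T 1) = P' * S m (T (-1)) + Q' + R' * S m (T 1)) :
    P = P' ∧ Q = Q' ∧ R = R' := by
  have h0 := h 0
  have h1 := h 1
  have h2 := h 2
  simp only [S_succ, S_zero, zero_add] at h0 h1 h2
  have hT : (T (-1) : L) * T 1 = 1 := by rw [← T_add]; simp
  have hT2 : (T 1 : L) ^ 2 = T 2 := by rw [T_pow]; norm_num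
  have hne : (T 1 : L) ^ 2 - 1 ≠ 0 := by rw [hT2]; exact sub_ne_zero.mpr T_two_ne_one
  generalize (T (-1) : L) = x at *
  generalize (T 1 : L) = y at *
  have e1 : (P - P') * x + (R - R') * y = 0 := by linear_combination h0 - h1
  have e2 : (P - P') * x ^ 2 + (R - R') * y ^ 2 = 0 := by linear_combination h2 - h1
  have e3 : (P - P') + (R - R') * y ^ 2 = 0 := by
    linear_combination y * e1 - (P - P') * hT
  have e4 : (P - P') + (R - R') * y ^ 4 = 0 := by
    linear_combination y ^ 2 * e2 - (P - P') * (x * y + 1) * hT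
  have e5 : (R - R') * (y ^ 2 - 1) = 0 := by
    linear_combination x ^ 2 * (e4 - e3) - (R - R') * (y ^ 2 - 1) * (x * y + 1) * hT
  have hR : R = R' := sub_eq_zero.mp ((mul_eq_zero.mp e5).resolve_right hne)
  have hP : P = P' := by
    subst hR
    linear_combination e3
  subst hR hP
  exact ⟨rfl, by linear_combination h0, rfl⟩

end
end

section
/- (Theorem 4.3, reduction step) Assume that for every element σ ≠ 1 of the subgroup of B₄ generated by the Bokut–Vesnin generators a and b there exists m ∈ ℕ such that the (3,1) entry ρ₃₁(a^m σ a^{−m}) of the Burau matrix is non-zero. Then the reduced Burau representation ρ : B₄ → GL₃(ℤ[t,t⁻¹]) is injective (faithful). -/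
open LaurentPolynomial Matrix

noncomputable section

/-- Braid relations on `k` Artin generators (`σᵢσⱼσᵢ = σⱼσᵢσⱼ` for `|i−j| = 1`,
`σᵢσⱼ = σⱼσᵢ` for `|i−j| > 1`). -/
def braidRels (k : ℕ) : Set (FreeGroup (Fin k)) :=
  {r | (∃ i j : Fin k, i.val + 1 = j.val ∧
        r = FreeGroup.of i * FreeGroup.of j * FreeGroup.of i *
            (FreeGroup.of j * FreeGroup.of i * FreeGroup.of j)⁻¹) ∨
       (∃ i j : Fin k, i.val + 1 < j.val ∧
        r = FreeGroup.of i * FreeGroup.of j * (FreeGroup.of j * FreeGroup.of i)⁻¹)}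

/-- The braid group `B₄`, presented by `⟨σ₁,σ₂,σ₃ | σ₁σ₂σ₁=σ₂σ₁σ₂, σ₂σ₃σ₂=σ₃σ₂σ₃, σ₁σ₃=σ₃σ₁⟩`. -/
abbrev B₄ := PresentedGroup (braidRels 3)

/-- The braid group `B₃`, presented by `⟨σ₁,σ₂ | σ₁σ₂σ₁=σ₂σ₁σ₂⟩`. -/
abbrev B₃ := PresentedGroup (braidRels 2)

/-- The Artin generators `σ₁, σ₂, σ₃` of `B₄` (zero-indexed). -/
def σ₄ (i : Fin 3) : B₄ := PresentedGroup.of i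

/-- The Artin generators `σ₁, σ₂` of `B₃` (zero-indexed). -/
def σ₃ (i : Fin 2) : B₃ := PresentedGroup.of i

/-- The reduced Burau matrices of the Artin generators `σ₁, σ₂, σ₃` of `B₄`. -/
def M : Fin 3 → Matrix (Fin 3) (Fin 3) L
  | 0 => !![-T (-1), 0, 0; T (-1), 1, 0; 0, 0, 1]
  | 1 => !![1, 1, 0; 0, -T (-1), 0; 0, T (-1), 1]
  | 2 => !![1, 0, 0; 0, 1, 1; 0, 0, -T (-1)]

/-- The first Bokut–Vesnin generator `a = σ₁σ₂σ₁⁻¹σ₃σ₂⁻¹σ₁⁻¹`. -/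
def a : B₄ := σ₄ 0 * σ₄ 1 * (σ₄ 0)⁻¹ * σ₄ 2 * (σ₄ 1)⁻¹ * (σ₄ 0)⁻¹

/-- The second Bokut–Vesnin generator `b = σ₃σ₁⁻¹`. -/
def b : B₄ := σ₄ 2 * (σ₄ 0)⁻¹

/-! ### Kernel of the map from the three-strand braid group to `SL(2, ℤ)` -/

/-- The product of a word in the two elements `x * y` and `x * y ^ 2`. -/
def syllableProd {G : Type*} [Group G] (x y : G) (w : List Bool) : G :=
  (w.map fun c => if c then x * y else x * y ^ 2).prod

/-- Normal form in a group generated by `x, y` with `x ^ 2 = y ^ 3`. -/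
theorem exists_normal_form {G : Type*} [Group G] {x y : G} (hxy : x ^ 2 = y ^ 3)
    (hgen : Subgroup.closure ({x, y} : Set G) = ⊤) (g : G) :
    ∃ (k : ℤ) (i : Fin 3) (w : List Bool) (j : Fin 2),
      g = (x ^ 2) ^ k * (y ^ (i : ℕ) * syllableProd x y w * x ^ (j : ℕ)) := by
  have hzx (k : ℤ) : x * (x ^ 2) ^ k = (x ^ 2) ^ k * x :=
    ((Commute.self_pow x 2).zpow_right k).eq
  have hzy (k : ℤ) : y * (x ^ 2) ^ k = (x ^ 2) ^ k * y := by
    rw [hxy]; exact ((Commute.self_pow y 3).zpow_right k).eq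
  let S : Set G := {g | ∃ (k : ℤ) (i : Fin 3) (w : List Bool) (j : Fin 2),
      g = (x ^ 2) ^ k * (y ^ (i : ℕ) * syllableProd x y w * x ^ (j : ℕ))}
  have hz (g : G) (hg : g ∈ S) (n : ℤ) : (x ^ 2) ^ n * g ∈ S := by
    obtain ⟨k, i, w, j, rfl⟩ := hg
    exact ⟨n + k, i, w, j, by simp only [_root_.zpow_add, mul_assoc]⟩
  have hy (g : G) (hg : g ∈ S) : y * g ∈ S := by
    obtain ⟨k, i, w, j, rfl⟩ := hg
    rw [← mul_assoc, hzy, mul_assoc]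
    refine hz _ ?_ k
    fin_cases i
    · exact ⟨0, 1, w, j, by simp [mul_assoc]⟩
    · exact ⟨0, 2, w, j, by simp [mul_assoc, pow_two]⟩
    · exact ⟨1, 0, w, j, by simp [mul_assoc, hxy, pow_succ]⟩
  have hx (g : G) (hg : g ∈ S) : x * g ∈ S := by
    obtain ⟨k, i, w, j, rfl⟩ := hg
    rw [← mul_assoc, hzx, mul_assoc]
    refine hz _ ?_ k
    fin_cases i
    · match w, j with
      | [], 0 => exact ⟨0, 0, [], 1, by simp [syllableProd]⟩
      | [], 1 => exact ⟨1, 0, [], 0, by simp [syllableProd, pow_two]⟩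
      | true :: w, j => exact ⟨1, 1, w, j, by simp [syllableProd, pow_two, mul_assoc]⟩
      | false :: w, j => exact ⟨1, 2, w, j, by simp [syllableProd, pow_two, mul_assoc]⟩
    · exact ⟨0, 0, true :: w, j, by simp [syllableProd, mul_assoc]⟩
    · exact ⟨0, 0, false :: w, j, by simp [syllableProd, mul_assoc]⟩
  have hxi : x⁻¹ = (x ^ 2) ^ (-1 : ℤ) * x := by group
  have hyi : y⁻¹ = (x ^ 2) ^ (-1 : ℤ) * (y * y) := by rw [hxy]; group
  have hg : g ∈ Subgroup.closure ({x, y} : Set G) := hgen ▸ Subgroup.mem_top g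
  change g ∈ S
  induction hg using Subgroup.closure_induction_left with
  | one => exact ⟨0, 0, [], 0, by simp [syllableProd]⟩
  | mul_left u hu v _ hv =>
    rcases hu with rfl | rfl
    exacts [hx v hv, hy v hv]
  | inv_mul_cancel u hu v _ hv =>
    rcases hu with rfl | rfl
    · rw [hxi, mul_assoc]; exact hz _ (hx v hv) _
    · rw [hyi, mul_assoc, mul_assoc]; exact hz _ (hy _ (hy v hv)) _

/-- Up to sign, words in `xy` and `xy²` map to non-negative matrices with positive diagonal,
which are not diagonal unless the word is empty. -/
theorem syllableProd_matrix {x y : SpecialLinearGroup (Fin 2) ℤ}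
    (hx : (x : Matrix (Fin 2) (Fin 2) ℤ) = !![0, 1; -1, 0])
    (hy : (y : Matrix (Fin 2) (Fin 2) ℤ) = !![1, 1; -1, 0]) (w : List Bool) :
    ∃ ε p q r s : ℤ, (ε = 1 ∨ ε = -1) ∧ 1 ≤ p ∧ 0 ≤ q ∧ 0 ≤ r ∧ 1 ≤ s ∧
      (w ≠ [] → 1 ≤ q + r) ∧
      ((syllableProd x y w : SpecialLinearGroup (Fin 2) ℤ) : Matrix (Fin 2) (Fin 2) ℤ) =
        ε • !![p, q; r, s] := by
  induction w with
  | nil =>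
    exact ⟨1, 1, 0, 0, 1, by simp, by simp, by simp, by simp, by simp, by simp,
      by simp [syllableProd, Matrix.one_fin_two]⟩
  | cons c w ih =>
    obtain ⟨ε, p, q, r, s, hε, hp, hq, hr, hs, -, hM⟩ := ih
    have hε' : -ε = 1 ∨ -ε = -1 := by omega
    cases c
    · refine ⟨-ε, p + r, q + s, r, s, hε', by omega, by omega, hr, hs, fun _ => by omega, ?_⟩
      have : syllableProd x y (false :: w) = x * (y * y) * syllableProd x y w := by
        simp [syllableProd, pow_two]
      rw [this]
      simp only [Matrix.SpecialLinearGroup.coe_mul, hM, hx, hy]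
      ext i j; fin_cases i <;> fin_cases j <;>
        simp [Matrix.mul_apply, Fin.sum_univ_two] <;> ring
    · refine ⟨-ε, p, q, p + r, q + s, hε', hp, hq, by omega, by omega, fun _ => by omega, ?_⟩
      have : syllableProd x y (true :: w) = x * y * syllableProd x y w := by
        simp [syllableProd]
      rw [this]
      simp only [Matrix.SpecialLinearGroup.coe_mul, hM, hx, hy]
      ext i j; fin_cases i <;> fin_cases j <;>
        simp [Matrix.mul_apply, Fin.sum_univ_two] <;> ring

/-- In a group generated by `s, t` with `sts = tst`, an element with trivial image in `SL(2, ℤ)`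
and exponent sum zero is trivial. -/
theorem eq_one_of_map_eq_one_of_exponent_eq_one {G : Type*} [Group G] {s t : G}
    (hst : s * t * s = t * s * t) (hgen : Subgroup.closure ({s, t} : Set G) = ⊤)
    (φ : G →* SpecialLinearGroup (Fin 2) ℤ)
    (hs : (φ s : Matrix (Fin 2) (Fin 2) ℤ) = !![1, 0; -1, 1])
    (ht : (φ t : Matrix (Fin 2) (Fin 2) ℤ) = !![1, 1; 0, 1])
    (e : G →* Multiplicative ℤ) (hes : e s = .ofAdd 1) (het : e t = .ofAdd 1)
    {g : G} (hφ : φ g = 1) (he : e g = 1) : g = 1 := by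
  let x := s * t * s
  let y := s * t
  have hxy : x ^ 2 = y ^ 3 := by
    calc x ^ 2 = s * t * s * (s * t * s) := pow_two _
      _ = s * t * s * (t * s * t) := by rw [hst]
      _ = y ^ 3 := by simp only [y, pow_succ, pow_zero, one_mul, mul_assoc]
  have hgen' : Subgroup.closure ({x, y} : Set G) = ⊤ := by
    have hxm : x ∈ Subgroup.closure ({x, y} : Set G) := Subgroup.subset_closure (by simp)
    have hym : y ∈ Subgroup.closure ({x, y} : Set G) := Subgroup.subset_closure (by simp)
    rw [← top_le_iff, ← hgen, Subgroup.closure_le]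
    have hs : y⁻¹ * x = s := by simp [x, y, mul_assoc]
    have ht : x * y⁻¹ = t := by simp only [x, y, hst]; group
    rintro _ (h | h)
    · rw [h, ← hs]; exact mul_mem (inv_mem hym) hxm
    · rw [h, ← ht]; exact mul_mem hxm (inv_mem hym)
  have hφx : (φ x : Matrix (Fin 2) (Fin 2) ℤ) = !![0, 1; -1, 0] := by
    simp [x, hs, ht]
  have hφy : (φ y : Matrix (Fin 2) (Fin 2) ℤ) = !![1, 1; -1, 0] := by
    simp [y, hs, ht]
  obtain ⟨k, i, w, j, rfl⟩ := exists_normal_form hxy hgen' g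
  obtain ⟨ε, p, q, r, u, hε, hp, hq, hr, hu, hw, hM⟩ := syllableProd_matrix hφx hφy w
  have hz : φ (x ^ 2) = -1 := by
    rw [map_pow, pow_two]
    ext i j
    rw [Matrix.SpecialLinearGroup.coe_mul, hφx]
    fin_cases i <;> fin_cases j <;> simp
  have hzk : ∃ δ : ℤ, (δ = 1 ∨ δ = -1) ∧
      (φ ((x ^ 2) ^ k) : Matrix (Fin 2) (Fin 2) ℤ) = δ • (1 : Matrix (Fin 2) (Fin 2) ℤ) := by
    rw [map_zpow, hz]
    rcases Int.even_or_odd' k with ⟨m, rfl | rfl⟩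
    · exact ⟨1, by simp, by simp [_root_.zpow_mul]⟩
    · exact ⟨-1, by simp, by simp [_root_.zpow_mul, _root_.zpow_add]⟩
  obtain ⟨δ, hδ, hzk⟩ := hzk
  have hmap : φ (syllableProd x y w) = syllableProd (φ x) (φ y) w := by
    simp only [syllableProd, map_list_prod, List.map_map]
    congr 2
    funext c
    cases c <;> simp
  have hmat : ε • δ • ((!![1, 1; -1, 0] : Matrix (Fin 2) (Fin 2) ℤ) ^ (i : ℕ) * !![p, q; r, u] *
      !![0, 1; -1, 0] ^ (j : ℕ)) = 1 := by
    have := congrArg (Subtype.val) hφ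
    simpa only [map_mul, Matrix.SpecialLinearGroup.coe_mul, map_pow,
      Matrix.SpecialLinearGroup.coe_pow, hzk, hmap, hM, hφx, hφy, Matrix.smul_mul, Matrix.mul_smul,
      one_mul, Matrix.SpecialLinearGroup.coe_one] using this
  have h00 := congrFun₂ hmat 0 0
  have h01 := congrFun₂ hmat 0 1
  have h10 := congrFun₂ hmat 1 0
  have key : i = 0 ∧ j = 0 ∧ w = [] := by
    rcases hδ with rfl | rfl <;> rcases hε with rfl | rfl <;> fin_cases i <;> fin_cases j <;>
      simp [pow_two, Matrix.vecHead, Matrix.vecTail] at h00 h01 h10 ⊢ <;>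
      first
        | omega
        | (by_contra hne; have := hw hne; omega)
  obtain ⟨rfl, rfl, rfl⟩ := key
  have hk : k = 0 := by
    have := congrArg Multiplicative.toAdd he
    simp [syllableProd, x, hes, het] at this
    omega
  simp [hk, syllableProd]

/-! ### The subgroup generated by `a` and `b` -/

theorem σ₄_comm : σ₄ 0 * σ₄ 2 = σ₄ 2 * σ₄ 0 := by
  have := PresentedGroup.one_of_mem (rels := braidRels 3)
    (x := FreeGroup.of 0 * FreeGroup.of 2 * (FreeGroup.of 2 * FreeGroup.of 0)⁻¹)
    (Or.inr ⟨0, 2, by decide, rfl⟩)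
  rw [map_mul, map_inv, mul_inv_eq_one] at this
  simp only [map_mul] at this
  exact this

theorem σ₄_braid_zero_one : σ₄ 0 * σ₄ 1 * σ₄ 0 = σ₄ 1 * σ₄ 0 * σ₄ 1 := by
  have := PresentedGroup.one_of_mem (rels := braidRels 3)
    (x := FreeGroup.of 0 * FreeGroup.of 1 * FreeGroup.of 0 *
      (FreeGroup.of 1 * FreeGroup.of 0 * FreeGroup.of 1)⁻¹)
    (Or.inl ⟨0, 1, by decide, rfl⟩)
  rw [map_mul, map_inv, mul_inv_eq_one] at this
  simp only [map_mul] at this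
  exact this

theorem σ₄_braid_one_two : σ₄ 1 * σ₄ 2 * σ₄ 1 = σ₄ 2 * σ₄ 1 * σ₄ 2 := by
  have := PresentedGroup.one_of_mem (rels := braidRels 3)
    (x := FreeGroup.of 1 * FreeGroup.of 2 * FreeGroup.of 1 *
      (FreeGroup.of 2 * FreeGroup.of 1 * FreeGroup.of 2)⁻¹)
    (Or.inl ⟨1, 2, by decide, rfl⟩)
  rw [map_mul, map_inv, mul_inv_eq_one] at this
  simp only [map_mul] at this
  exact this

theorem closure_σ₄ : Subgroup.closure {σ₄ 0, σ₄ 1, σ₄ 2} = ⊤ := by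
  rw [← PresentedGroup.closure_range_of (braidRels 3)]
  congr 1
  ext g
  simp [Fin.exists_fin_succ, σ₄, eq_comm]

theorem commute_σ₄_zero_b : Commute (σ₄ 0) b :=
  Commute.mul_right σ₄_comm (Commute.refl _).inv_right

theorem b_mul_σ₄_zero : b * σ₄ 0 = σ₄ 2 := by simp [b]

theorem b_eq : b = (σ₄ 0)⁻¹ * σ₄ 2 :=
  (show Commute (σ₄ 0) (σ₄ 2) from σ₄_comm).inv_left.eq.symm

theorem a_eq : a = σ₄ 0 * σ₄ 1 * b * (σ₄ 0 * σ₄ 1)⁻¹ := by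
  rw [a, b_eq]
  group

theorem σ₄_one_mul_a : σ₄ 1 * a = a * σ₄ 1 := by
  have h : σ₄ 1 * (σ₄ 0 * σ₄ 1) = σ₄ 0 * σ₄ 1 * σ₄ 0 := by
    rw [σ₄_braid_zero_one, mul_assoc]
  calc σ₄ 1 * a = σ₄ 1 * (σ₄ 0 * σ₄ 1) * b * (σ₄ 0 * σ₄ 1)⁻¹ := by rw [a_eq]; group
    _ = σ₄ 0 * σ₄ 1 * (σ₄ 0 * b) * (σ₄ 0 * σ₄ 1)⁻¹ := by rw [h]; group
    _ = σ₄ 0 * σ₄ 1 * b * (σ₄ 0 * σ₄ 1)⁻¹ * (σ₄ 0 * σ₄ 1 * σ₄ 0) * (σ₄ 0 * σ₄ 1)⁻¹ := by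
      rw [commute_σ₄_zero_b.eq]; group
    _ = a * σ₄ 1 := by rw [← h, a_eq]; group

theorem σ₄_one_mul_b : σ₄ 1 * b = b * a * σ₄ 1 := by
  calc σ₄ 1 * b = σ₄ 1 * σ₄ 2 * σ₄ 1 * (σ₄ 1 * σ₄ 0 * σ₄ 1)⁻¹ * σ₄ 1 := by rw [b]; group
    _ = b * a * σ₄ 1 := by
      rw [σ₄_braid_one_two, ← σ₄_braid_zero_one, a_eq, b]; group

theorem σ₄_zero_mul_a : b * (σ₄ 0 * a) = a * σ₄ 0 := by
  calc b * (σ₄ 0 * a) = σ₄ 2 * σ₄ 0 * σ₄ 1 * b * (σ₄ 0 * σ₄ 1)⁻¹ := by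
        rw [← mul_assoc, b_mul_σ₄_zero, a_eq]; group
    _ = σ₄ 0 * (σ₄ 2 * σ₄ 1 * σ₄ 2) * (σ₄ 0 * σ₄ 1 * σ₄ 0)⁻¹ := by
      rw [← σ₄_comm, b]; group
    _ = a * σ₄ 0 := by
      rw [← σ₄_braid_one_two, σ₄_braid_zero_one, a_eq, b]; group

/-- An element normalizes `⟨S⟩` if it and its inverse conjugate `S` into `⟨S⟩`. -/
theorem mem_normalizer_closure {G : Type*} [Group G] {S : Set G} {g : G}
    (h : ∀ s ∈ S, g * s * g⁻¹ ∈ Subgroup.closure S)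
    (h' : ∀ s ∈ S, g⁻¹ * s * g ∈ Subgroup.closure S) :
    g ∈ Subgroup.normalizer (Subgroup.closure S : Set G) := by
  have aux {g : G} (h : ∀ s ∈ S, g * s * g⁻¹ ∈ Subgroup.closure S) :
      Subgroup.closure S ≤ (Subgroup.closure S).comap (MulAut.conj g).toMonoidHom := by
    rw [Subgroup.closure_le]
    exact h
  rw [Subgroup.mem_normalizer_iff]
  refine fun n => ⟨fun hn => aux h hn, fun hn => ?_⟩
  have := aux (g := g⁻¹) (by simpa using h') hn
  simpa [mul_assoc] using this

instance normal_closure_a_b : (Subgroup.closure ({a, b} : Set B₄)).Normal := by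
  have ha : a ∈ Subgroup.closure ({a, b} : Set B₄) := Subgroup.subset_closure (by simp)
  have hb : b ∈ Subgroup.closure ({a, b} : Set B₄) := Subgroup.subset_closure (by simp)
  have h0 : σ₄ 0 ∈ Subgroup.normalizer (Subgroup.closure ({a, b} : Set B₄) : Set B₄) := by
    have e1 : σ₄ 0 * a * (σ₄ 0)⁻¹ = b⁻¹ * a := by
      rw [eq_inv_mul_iff_mul_eq, ← mul_assoc, σ₄_zero_mul_a, mul_inv_cancel_right]
    have e2 : σ₄ 0 * b * (σ₄ 0)⁻¹ = b := by
      rw [commute_σ₄_zero_b.eq, mul_inv_cancel_right]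
    have e3 : (σ₄ 0)⁻¹ * b * σ₄ 0 = b := by
      rw [mul_assoc, ← commute_σ₄_zero_b.eq, inv_mul_cancel_left]
    have e4 : (σ₄ 0)⁻¹ * a * σ₄ 0 = b * a := by
      rw [mul_assoc, inv_mul_eq_iff_eq_mul, ← σ₄_zero_mul_a, ← mul_assoc, ← mul_assoc,
        commute_σ₄_zero_b.eq]
    refine mem_normalizer_closure ?_ ?_ <;> rintro s (h | h) <;> rw [h]
    · rw [e1]; exact mul_mem (inv_mem hb) ha
    · rwa [e2]
    · rw [e4]; exact mul_mem hb ha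
    · rwa [e3]
  have h1 : σ₄ 1 ∈ Subgroup.normalizer (Subgroup.closure ({a, b} : Set B₄) : Set B₄) := by
    have e1 : σ₄ 1 * a * (σ₄ 1)⁻¹ = a := by
      rw [σ₄_one_mul_a, mul_inv_cancel_right]
    have e2 : (σ₄ 1)⁻¹ * a * σ₄ 1 = a := by
      rw [mul_assoc, ← σ₄_one_mul_a, inv_mul_cancel_left]
    have e3 : σ₄ 1 * b * (σ₄ 1)⁻¹ = b * a := by
      rw [σ₄_one_mul_b, mul_inv_cancel_right]
    have e4 : (σ₄ 1)⁻¹ * b * σ₄ 1 = b * a⁻¹ := by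
      rw [mul_assoc, inv_mul_eq_iff_eq_mul, ← mul_assoc, eq_mul_inv_iff_mul_eq, mul_assoc,
        σ₄_one_mul_a, ← mul_assoc, σ₄_one_mul_b]
    refine mem_normalizer_closure ?_ ?_ <;> rintro s (h | h) <;> rw [h]
    · rwa [e1]
    · rw [e3]; exact mul_mem hb ha
    · rwa [e2]
    · rw [e4]; exact mul_mem hb (inv_mem ha)
  rw [← Subgroup.normalizer_eq_top_iff, ← top_le_iff, ← closure_σ₄, Subgroup.closure_le]
  rintro g (h | h | h) <;> rw [h]
  · exact h0
  · exact h1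
  · rw [← b_mul_σ₄_zero]
    exact mul_mem (Subgroup.le_normalizer hb) h0

/-! ### The kernel of the Burau representation lies in the subgroup generated by `a` and `b` -/

/-- A map out of `B₄` from three elements satisfying the braid relations. -/
def liftB₄ {G : Type*} [Group G] (f : Fin 3 → G) (h01 : f 0 * f 1 * f 0 = f 1 * f 0 * f 1)
    (h12 : f 1 * f 2 * f 1 = f 2 * f 1 * f 2) (h02 : f 0 * f 2 = f 2 * f 0) : B₄ →* G :=
  PresentedGroup.toGroup (rels := braidRels 3) (f := f) <| by
    rintro r (⟨i, j, hij, rfl⟩ | ⟨i, j, hij, rfl⟩) <;> fin_cases i <;> fin_cases j <;>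
      simp_all

theorem liftB₄_σ₄ {G : Type*} [Group G] (f : Fin 3 → G) (h01 h12 h02) (i : Fin 3) :
    liftB₄ f h01 h12 h02 (σ₄ i) = f i :=
  PresentedGroup.toGroup.of _

/-- The exponent sum of a braid. -/
def exponentSum : B₄ →* Multiplicative ℤ :=
  liftB₄ (fun _ => .ofAdd 1) rfl rfl rfl

theorem exponentSum_σ₄ (i : Fin 3) : exponentSum (σ₄ i) = .ofAdd 1 := liftB₄_σ₄ _ _ _ _ i

/-- The composite of `B₄ → B₃` with the standard map `B₃ → SL(2, ℤ)`. -/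
def toSL₂ : B₄ →* SpecialLinearGroup (Fin 2) ℤ :=
  liftB₄ ![⟨!![1, 0; -1, 1], by simp⟩, ⟨!![1, 1; 0, 1], by simp⟩, ⟨!![1, 0; -1, 1], by simp⟩]
    (Subtype.ext (by decide)) (Subtype.ext (by decide)) rfl

theorem toSL₂_σ₄_zero : toSL₂ (σ₄ 0) = ⟨!![1, 0; -1, 1], by simp⟩ := liftB₄_σ₄ _ _ _ _ 0
theorem toSL₂_σ₄_one : toSL₂ (σ₄ 1) = ⟨!![1, 1; 0, 1], by simp⟩ := liftB₄_σ₄ _ _ _ _ 1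
theorem toSL₂_σ₄_two : toSL₂ (σ₄ 2) = ⟨!![1, 0; -1, 1], by simp⟩ := liftB₄_σ₄ _ _ _ _ 2

/-- A hom that agrees on `σ₁` and `σ₃` kills `⟨a, b⟩`. -/
theorem closure_a_b_le_ker {G : Type*} [Group G] (f : B₄ →* G) (hf : f (σ₄ 0) = f (σ₄ 2)) :
    Subgroup.closure ({a, b} : Set B₄) ≤ f.ker := by
  have hb : f b = 1 := by rw [b, map_mul, map_inv, hf, mul_inv_cancel]
  rw [Subgroup.closure_le]
  rintro g (h | h) <;> rw [h, SetLike.mem_coe, MonoidHom.mem_ker]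
  · rw [a_eq]; simp [hb]
  · exact hb

/-- A braid with trivial image in `SL(2, ℤ)` and exponent sum zero lies in `⟨a, b⟩`. -/
theorem mem_closure_a_b {g : B₄} (hφ : toSL₂ g = 1) (he : exponentSum g = 1) :
    g ∈ Subgroup.closure ({a, b} : Set B₄) := by
  have hφN : Subgroup.closure ({a, b} : Set B₄) ≤ toSL₂.ker :=
    closure_a_b_le_ker _ (by rw [toSL₂_σ₄_zero, toSL₂_σ₄_two])
  have heN : Subgroup.closure ({a, b} : Set B₄) ≤ exponentSum.ker :=
    closure_a_b_le_ker _ (by rw [exponentSum_σ₄, exponentSum_σ₄])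
  let π := QuotientGroup.mk' (Subgroup.closure ({a, b} : Set B₄))
  have hπ : π (σ₄ 2) = π (σ₄ 0) := by
    rw [← b_mul_σ₄_zero, map_mul, mul_eq_right]
    exact (QuotientGroup.eq_one_iff b).2 (Subgroup.subset_closure (by simp))
  rw [← QuotientGroup.eq_one_iff]
  refine eq_one_of_map_eq_one_of_exponent_eq_one (s := π (σ₄ 0)) (t := π (σ₄ 1)) ?_ ?_
    (QuotientGroup.lift _ toSL₂ hφN) ?_ ?_ (QuotientGroup.lift _ exponentSum heN) ?_ ?_ ?_ ?_
  · simp only [← map_mul, σ₄_braid_zero_one]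
  · have := congrArg (Subgroup.map π) closure_σ₄
    rw [MonoidHom.map_closure, Set.image_insert_eq, Set.image_insert_eq, Set.image_singleton, hπ,
      Subgroup.map_top_of_surjective _ (QuotientGroup.mk'_surjective _)] at this
    rw [← this]
    congr 1
    ext; simp only [Set.mem_insert_iff, Set.mem_singleton_iff]; tauto
  · exact congrArg Subtype.val toSL₂_σ₄_zero
  · exact congrArg Subtype.val toSL₂_σ₄_one
  · exact exponentSum_σ₄ 0
  · exact exponentSum_σ₄ 1
  · exact hφ
  · exact he

theorem exponentSum_eq_one_of_burau_eq_one {ρ : B₄ →* GL (Fin 3) L}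
    (hρ : ∀ i : Fin 3, (ρ (σ₄ i) : Matrix (Fin 3) (Fin 3) L) = M i)
    {g : B₄} (hg : ρ g = 1) : exponentSum g = 1 := by
  let u : ℚˣ := Units.mk0 (-1 / 2) (by norm_num)
  let f : B₄ →* ℚˣ := (Units.map (eval₂ (Int.castRingHom ℚ) u).toMonoidHom).comp
    (GeneralLinearGroup.det.comp ρ)
  have hf : f = (zpowersHom ℚˣ (Units.mk0 2 two_ne_zero)).comp exponentSum := by
    refine PresentedGroup.ext fun i => ?_
    change f (σ₄ i) = zpowersHom ℚˣ _ (exponentSum (σ₄ i))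
    rw [exponentSum_σ₄]
    ext
    simp [f, hρ]
    fin_cases i <;> simp [M, det_fin_three, u] <;> norm_num
  have := congrArg Units.val (DFunLike.congr_fun hf g)
  simp [f, hg, zpowersHom_apply] at this
  exact toAdd_eq_zero.1 ((zpow_eq_one_iff_right₀ zero_le_two (by norm_num)).1 this.symm)

theorem toSL₂_eq_one_of_burau_eq_one {ρ : B₄ →* GL (Fin 3) L}
    (hρ : ∀ i : Fin 3, (ρ (σ₄ i) : Matrix (Fin 3) (Fin 3) L) = M i)
    {g : B₄} (hg : ρ g = 1) : toSL₂ g = 1 := by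
  let ev : L →+* ℤ := eval₂ (RingHom.id ℤ) (-1)
  let P : Matrix (Fin 3) (Fin 2) ℤ := !![1, 0; 0, 1; -1, 0]
  have key (g : B₄) : (GeneralLinearGroup.map ev (ρ g) : Matrix (Fin 3) (Fin 3) ℤ) * P =
      P * (toSL₂ g : Matrix (Fin 2) (Fin 2) ℤ) := by
    have hg : g ∈ Subgroup.closure {σ₄ 0, σ₄ 1, σ₄ 2} := closure_σ₄ ▸ Subgroup.mem_top g
    induction hg using Subgroup.closure_induction with
    | one => simp
    | mul x y _ _ hx hy =>
      simp only [map_mul, Units.val_mul, Matrix.SpecialLinearGroup.coe_mul]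
      rw [Matrix.mul_assoc, hy, ← Matrix.mul_assoc, hx, Matrix.mul_assoc]
    | inv x _ hx =>
      have hinv : (GeneralLinearGroup.map ev (ρ x⁻¹) : Matrix (Fin 3) (Fin 3) ℤ) *
          (GeneralLinearGroup.map ev (ρ x) : Matrix (Fin 3) (Fin 3) ℤ) = 1 := by
        rw [← Units.val_mul, ← map_mul, ← map_mul, inv_mul_cancel]; simp
      have hinv' : (toSL₂ x : Matrix (Fin 2) (Fin 2) ℤ) *
          (toSL₂ x⁻¹ : Matrix (Fin 2) (Fin 2) ℤ) = 1 := by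
        rw [← Matrix.SpecialLinearGroup.coe_mul, ← map_mul, mul_inv_cancel]; simp
      calc _ = (GeneralLinearGroup.map ev (ρ x⁻¹) : Matrix (Fin 3) (Fin 3) ℤ) *
            (P * (toSL₂ x : Matrix (Fin 2) (Fin 2) ℤ)) *
            (toSL₂ x⁻¹ : Matrix (Fin 2) (Fin 2) ℤ) := by
              rw [Matrix.mul_assoc, Matrix.mul_assoc, hinv', Matrix.mul_one]
        _ = _ := by rw [← hx, ← Matrix.mul_assoc, hinv, Matrix.one_mul]
    | mem x hx =>
      have hev (i : Fin 3) : (GeneralLinearGroup.map ev (ρ (σ₄ i)) : Matrix (Fin 3) (Fin 3) ℤ) =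
          (M i).map ev := by rw [← hρ]; rfl
      rcases hx with h | h | h <;> rw [h, hev]
      · rw [toSL₂_σ₄_zero]
        ext i j
        fin_cases i <;> fin_cases j <;>
          simp [M, P, ev, Matrix.mul_apply, Fin.sum_univ_succ]
      · rw [toSL₂_σ₄_one]
        ext i j
        fin_cases i <;> fin_cases j <;>
          simp [M, P, ev, Matrix.mul_apply, Fin.sum_univ_succ]
      · rw [toSL₂_σ₄_two]
        ext i j
        fin_cases i <;> fin_cases j <;>
          simp [M, P, ev, Matrix.mul_apply, Fin.sum_univ_succ]
  have hP := key g
  have hQ : (!![1, 0, 0; 0, 1, 0] : Matrix (Fin 2) (Fin 3) ℤ) * P = 1 := by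
    simp [P, Matrix.one_fin_two]
  rw [hg, map_one, Units.val_one, Matrix.one_mul] at hP
  apply Subtype.ext
  rw [Matrix.SpecialLinearGroup.coe_one, ← hQ, hP, ← Matrix.mul_assoc, hQ, Matrix.one_mul]

/-- The kernel of the Burau representation is contained in `⟨a, b⟩`. -/
theorem burau_ker_le {ρ : B₄ →* GL (Fin 3) L}
    (hρ : ∀ i : Fin 3, (ρ (σ₄ i) : Matrix (Fin 3) (Fin 3) L) = M i) :
    ρ.ker ≤ Subgroup.closure ({a, b} : Set B₄) := fun _ hg =>
  mem_closure_a_b (toSL₂_eq_one_of_burau_eq_one hρ hg)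
    (exponentSum_eq_one_of_burau_eq_one hρ hg)

/-- (Theorem 4.3, reduction step) If for every non-trivial element `σ` of the subgroup of
`B₄` generated by the Bokut–Vesnin generators `a, b` there is `m ∈ ℕ` with
`ρ₃₁(a^m σ a^{−m}) ≠ 0`, then the reduced Burau representation is faithful. -/
theorem burau_faithful_of_regularity
    (ρ : B₄ →* GL (Fin 3) L)
    (hρ : ∀ i : Fin 3, (ρ (σ₄ i) : Matrix (Fin 3) (Fin 3) L) = M i)
    (h : ∀ σ ∈ Subgroup.closure ({a, b} : Set B₄), σ ≠ 1 →
      ∃ m : ℕ, (ρ (a ^ m * σ * (a ^ m)⁻¹) : Matrix (Fin 3) (Fin 3) L) 2 0 ≠ 0) :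
    Function.Injective ρ := by
  rw [injective_iff_map_eq_one]
  intro σ hσ
  by_contra hne
  obtain ⟨m, hm⟩ := h σ (burau_ker_le hρ hσ) hne
  simp [hσ] at hm

end
end
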